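/- Let 0 < α < 1, let (λ_n)_{n≥1} be positive reals with λ_n ≥ λ₁ > 0 for all n, and let (ψ_n)_{n≥1} be reals with ∑_{n=1}^∞ |ψ_n|/λ_n < ∞ and ∑_{n=1}^∞ |ψ_n|/λ_n² < ∞. Then there exist constants C > 0 and t₀ > 0 such that for every t ≥ t₀, | ∑_{n=1}^∞ E_{α,1}(−λ_n t^α) ψ_n − (1/(Γ(1−α) t^α)) ∑_{n=1}^∞ ψ_n/λ_n | ≤ C t^{−2α}. -/

import Mathlib

/-- The Mittag-Leffler function `E_{α,β}(x) = ∑_{k=0}^∞ x^k / Γ(αk + β)` for real `x`,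
where `1/Γ` is interpreted as its entire extension (Mathlib's `Real.Gamma` vanishes at the
poles, so division yields `0` there). The series converges absolutely for every `x`. -/
noncomputable def mittagLeffler (α β x : ℝ) : ℝ :=
  ∑' k : ℕ, x ^ k / Real.Gamma (α * k + β)

open MeasureTheory Set Filter Topology

theorem Real.rpow_mul_exp_neg_div_le_Gamma {R y : ℝ} (hR : 1 ≤ R) (hy : 0 < y) :
    Real.exp (-(R + 1)) / (R + 1) * R ^ y ≤ Real.Gamma y := by
  have hR0 : 0 < R := by linarith
  rw [Real.Gamma_eq_integral hy]
  have hint := Real.GammaIntegral_convergent hy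
  have hsub : Ioc R (R + 1) ⊆ Ioi 0 := fun x hx => hR0.trans hx.1
  calc Real.exp (-(R + 1)) / (R + 1) * R ^ y
      = ∫ _ in Ioc R (R + 1), Real.exp (-(R + 1)) / (R + 1) * R ^ y := by simp
    _ ≤ ∫ x in Ioc R (R + 1), Real.exp (-x) * x ^ (y - 1) := by
        refine setIntegral_mono_on (integrableOn_const (by simp)) (hint.mono_set hsub) measurableSet_Ioc ?_
        intro x hx
        have hx0 : 0 < x := hR0.trans hx.1
        rw [Real.rpow_sub_one hx0.ne', div_mul_eq_mul_div, mul_div_assoc]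
        have h1 : R ^ y ≤ x ^ y := Real.rpow_le_rpow hR0.le hx.1.le hy.le
        have h2 : R ^ y / (R + 1) ≤ x ^ y / x := div_le_div₀ (by positivity) h1 hx0 hx.2
        have h3 : Real.exp (-(R + 1)) ≤ Real.exp (-x) := Real.exp_le_exp.2 (by linarith [hx.2])
        exact mul_le_mul h3 h2 (by positivity) (by positivity)
    _ ≤ ∫ x in Ioi 0, Real.exp (-x) * x ^ (y - 1) := by
        refine setIntegral_mono_set hint ?_ hsub.eventuallyLE
        filter_upwards [ae_restrict_mem measurableSet_Ioi] with x hx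
        have : (0 : ℝ) < x := hx
        positivity

theorem summable_pow_div_Gamma {α β : ℝ} (hα : 0 < α) (hβ : 0 < β) {x : ℝ} (hx : 0 ≤ x) :
    Summable (fun k : ℕ => x ^ k / Real.Gamma (α * k + β)) := by
  set M : ℝ := 1 + 2 * x with hM
  have hM1 : 1 ≤ M := by linarith
  set R : ℝ := M ^ (α⁻¹) with hRdef
  have hR1 : 1 ≤ R := Real.one_le_rpow hM1 (by positivity)
  have hRα : R ^ α = M := Real.rpow_inv_rpow (by linarith) hα.ne'
  have hR0 : 0 < R := by linarith
  set c : ℝ := Real.exp (-(R + 1)) / (R + 1) * R ^ β with hc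
  have hc0 : 0 < c := by positivity
  refine Summable.of_nonneg_of_le (f := fun k : ℕ => c⁻¹ * (1 / 2 : ℝ) ^ k) ?_ ?_
    (summable_geometric_two.mul_left _)
  · intro k
    have : 0 < Real.Gamma (α * k + β) := Real.Gamma_pos_of_pos (by positivity)
    positivity
  · intro k
    have hk : 0 < α * k + β := by positivity
    have h := Real.rpow_mul_exp_neg_div_le_Gamma hR1 hk
    have hpow : R ^ (α * k + β) = M ^ k * R ^ β := by
      rw [Real.rpow_add hR0, Real.rpow_mul hR0.le, hRα, Real.rpow_natCast]
    have h' : c * M ^ k ≤ Real.Gamma (α * k + β) := by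
      rw [hpow] at h; rw [hc]; linarith
    have h2 : x ^ k ≤ (1 / 2 : ℝ) ^ k * M ^ k := by
      rw [← mul_pow]; exact pow_le_pow_left₀ hx (by linarith) k
    rw [div_le_iff₀ (Real.Gamma_pos_of_pos hk)]
    calc x ^ k ≤ (1 / 2 : ℝ) ^ k * M ^ k := h2
      _ = c⁻¹ * (1 / 2 : ℝ) ^ k * (c * M ^ k) := by field_simp
      _ ≤ _ := by gcongr

theorem summable_mittagLeffler {α β : ℝ} (hα : 0 < α) (hβ : 0 < β) (x : ℝ) :
    Summable (fun k : ℕ => x ^ k / Real.Gamma (α * k + β)) := by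
  refine Summable.of_norm ((summable_pow_div_Gamma hα hβ (abs_nonneg x)).congr fun k => ?_)
  have : 0 < Real.Gamma (α * k + β) := Real.Gamma_pos_of_pos (by positivity)
  rw [norm_div, norm_pow, Real.norm_eq_abs, Real.norm_eq_abs, abs_of_pos this]

theorem continuous_mittagLeffler {α β : ℝ} (hα : 0 < α) (hβ : 0 < β) :
    Continuous (mittagLeffler α β) := by
  refine continuous_iff_continuousAt.2 fun x₀ => ?_
  have hon : ContinuousOn (mittagLeffler α β) (Metric.closedBall 0 (|x₀| + 1)) := by
    refine continuousOn_tsum (fun k => by fun_prop)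
      (summable_pow_div_Gamma hα hβ (x := |x₀| + 1) (by positivity)) fun k x hx => ?_
    have : 0 < Real.Gamma (α * k + β) := Real.Gamma_pos_of_pos (by positivity)
    rw [norm_div, norm_pow, Real.norm_eq_abs (Real.Gamma _), abs_of_pos this]
    have hx' : ‖x‖ ≤ |x₀| + 1 := by simpa using hx
    gcongr
  refine hon.continuousAt (Filter.mem_of_superset
    (Metric.closedBall_mem_nhds x₀ one_pos) fun y hy => ?_)
  rw [Metric.mem_closedBall, Real.dist_eq] at hy
  rw [mem_closedBall_zero_iff, Real.norm_eq_abs]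
  have := abs_add_le (y - x₀) x₀
  rw [sub_add_cancel] at this
  linarith

/-- The Riemann-Liouville kernel `t ^ (γ - 1) / Γ(γ)`. -/
noncomputable def powerKernel (γ t : ℝ) : ℝ := t ^ (γ - 1) / Real.Gamma γ

/-- The function `t ^ (β - 1) E_{α,β}(-t ^ α)`. -/
noncomputable def mittagLefflerKernel (α β t : ℝ) : ℝ :=
  t ^ (β - 1) * mittagLeffler α β (-t ^ α)

theorem powerKernel_pos {γ t : ℝ} (hγ : 0 < γ) (ht : 0 < t) : 0 < powerKernel γ t :=
  div_pos (Real.rpow_pos_of_pos ht _) (Real.Gamma_pos_of_pos hγ)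

theorem powerKernel_nonneg {γ t : ℝ} (hγ : 0 < γ) (ht : 0 ≤ t) : 0 ≤ powerKernel γ t :=
  div_nonneg (Real.rpow_nonneg ht _) (Real.Gamma_pos_of_pos hγ).le

theorem powerKernel_one (t : ℝ) : powerKernel 1 t = 1 := by
  simp [powerKernel]

theorem mul_powerKernel {γ t : ℝ} (hγ : 0 < γ) (ht : 0 ≤ t) :
    t * powerKernel γ t = γ * powerKernel (γ + 1) t := by
  rcases ht.eq_or_lt with rfl | ht
  · simp [powerKernel, Real.zero_rpow hγ.ne']
  rw [powerKernel, powerKernel, Real.Gamma_add_one hγ.ne', add_sub_cancel_right,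
    Real.rpow_sub_one ht.ne']
  have := (Real.Gamma_pos_of_pos hγ).ne'
  field_simp

theorem continuousOn_mittagLefflerKernel {α β : ℝ} (hα : 0 < α) (hβ : 0 < β) :
    ContinuousOn (mittagLefflerKernel α β) (Ioi 0) :=
  (continuousOn_id.rpow_const fun _ hx => Or.inl (ne_of_gt hx)).mul
    ((continuous_mittagLeffler hα hβ).comp
      (Real.continuous_rpow_const hα.le).neg).continuousOn

theorem integral_powerKernel_mul {γ β t : ℝ} (hγ : 0 < γ) (hβ : 0 < β) (ht : 0 < t) :
    ∫ s in (0 : ℝ)..t, powerKernel γ (t - s) * powerKernel β s = powerKernel (γ + β) t := by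
  have hΓγ := (Real.Gamma_pos_of_pos hγ).ne'
  have hΓβ := (Real.Gamma_pos_of_pos hβ).ne'
  have hc := Complex.betaIntegral_scaled (β : ℂ) (γ : ℂ) ht
  rw [Complex.betaIntegral_eq_Gamma_mul_div _ _ (by simpa) (by simpa)] at hc
  have hreal : ∫ s in (0 : ℝ)..t, s ^ (β - 1) * (t - s) ^ (γ - 1)
      = t ^ (β + γ - 1) * (Real.Gamma β * Real.Gamma γ / Real.Gamma (β + γ)) := by
    apply Complex.ofReal_injective
    rw [← intervalIntegral.integral_ofReal]
    refine Eq.trans (Eq.trans ?_ hc) ?_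
    · refine intervalIntegral.integral_congr fun s hs => ?_
      rw [uIcc_of_le ht.le] at hs
      rw [Complex.ofReal_mul, Complex.ofReal_cpow hs.1, Complex.ofReal_cpow (sub_nonneg.2 hs.2)]
      push_cast; rfl
    · rw [← Complex.ofReal_add, Complex.Gamma_ofReal, Complex.Gamma_ofReal, Complex.Gamma_ofReal]
      push_cast [Complex.ofReal_cpow ht.le]
      rfl
  calc ∫ s in (0 : ℝ)..t, powerKernel γ (t - s) * powerKernel β s
      = ∫ s in (0 : ℝ)..t, (Real.Gamma γ * Real.Gamma β)⁻¹ * (s ^ (β - 1) * (t - s) ^ (γ - 1)) := by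
        refine intervalIntegral.integral_congr fun s _ => ?_
        simp only [powerKernel]
        field_simp
    _ = _ := by
        rw [intervalIntegral.integral_const_mul, hreal, powerKernel, add_comm γ β]
        field_simp

theorem intervalIntegrable_powerKernel_mul {γ β t : ℝ} (hγ : 0 < γ) (hβ : 0 < β) (ht : 0 < t) :
    IntervalIntegrable (fun s => powerKernel γ (t - s) * powerKernel β s) volume 0 t := by
  apply intervalIntegral.intervalIntegrable_of_integral_ne_zero
  rw [integral_powerKernel_mul hγ hβ ht]
  exact (powerKernel_pos (by positivity) ht).ne'

theorem intervalIntegrable_powerKernel_mul_mittagLefflerKernel {α β γ t : ℝ} (hα : 0 < α)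
    (hβ : 0 < β) (hγ : 0 < γ) (ht : 0 < t) :
    IntervalIntegrable (fun s => powerKernel γ (t - s) * mittagLefflerKernel α β s)
      volume 0 t := by
  have h := (intervalIntegrable_powerKernel_mul hγ hβ ht).mul_continuousOn
    (g := fun s => Real.Gamma β * mittagLeffler α β (-s ^ α))
    (((continuous_mittagLeffler hα hβ).comp
      (Real.continuous_rpow_const hα.le).neg).const_mul _).continuousOn
  refine h.congr fun s _ => ?_
  have := (Real.Gamma_pos_of_pos hβ).ne'
  simp only [powerKernel, mittagLefflerKernel]
  field_simp

theorem hasSum_mittagLefflerKernel {α β t : ℝ} (hα : 0 < α) (hβ : 0 < β) (ht : 0 < t) :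
    HasSum (fun k : ℕ => (-1 : ℝ) ^ k * powerKernel (α * k + β) t)
      (mittagLefflerKernel α β t) := by
  have h := (summable_mittagLeffler hα hβ (-t ^ α)).hasSum.mul_left (t ^ (β - 1))
  refine (congrArg (HasSum · _) (funext fun k => ?_)).mpr h
  rw [powerKernel, add_sub_assoc, Real.rpow_add ht, Real.rpow_mul ht.le, Real.rpow_natCast,
    neg_pow]
  ring

theorem summable_powerKernel {α β t : ℝ} (hα : 0 < α) (hβ : 0 < β) (ht : 0 < t) :
    Summable (fun k : ℕ => powerKernel (α * k + β) t) := by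
  refine ((summable_mittagLeffler hα hβ (t ^ α)).mul_left (t ^ (β - 1))).congr fun k => ?_
  rw [powerKernel, add_sub_assoc, Real.rpow_add ht, Real.rpow_mul ht.le, Real.rpow_natCast]
  ring

theorem mittagLefflerKernel_eq_sub {α β t : ℝ} (hα : 0 < α) (hβ : 0 < β) (ht : 0 < t) :
    mittagLefflerKernel α β t = powerKernel β t - mittagLefflerKernel α (α + β) t := by
  have h1 := hasSum_mittagLefflerKernel hα hβ ht
  have h2 := (hasSum_mittagLefflerKernel hα (add_pos hα hβ) ht).neg
  rw [← h1.tsum_eq, h1.summable.tsum_eq_zero_add, sub_eq_add_neg, ← h2.tsum_eq]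
  congr 1
  · simp
  · refine tsum_congr fun k => ?_
    push_cast
    rw [pow_succ]
    ring_nf

theorem integral_powerKernel_mul_mittagLefflerKernel {α β γ t : ℝ} (hα : 0 < α)
    (hβ : 0 < β) (hγ : 0 < γ) (ht : 0 < t) :
    ∫ s in (0 : ℝ)..t, powerKernel γ (t - s) * mittagLefflerKernel α β s
      = mittagLefflerKernel α (γ + β) t := by
  have hpos (k : ℕ) : 0 < α * k + β := by positivity
  have hterm (k : ℕ) := integral_powerKernel_mul hγ (hpos k) ht
  have hnorm (k : ℕ) : ∫ s in Ioc 0 t,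
      ‖(-1 : ℝ) ^ k * (powerKernel γ (t - s) * powerKernel (α * k + β) s)‖
        = powerKernel (α * k + (γ + β)) t := by
    rw [show α * k + (γ + β) = γ + (α * k + β) by ring, ← hterm k,
      intervalIntegral.integral_of_le ht.le]
    refine setIntegral_congr_fun measurableSet_Ioc fun s hs => ?_
    simp only [norm_mul, norm_pow, norm_neg, norm_one, one_pow, one_mul, Real.norm_eq_abs]
    rw [abs_of_nonneg (powerKernel_nonneg hγ (sub_nonneg.2 hs.2)),
      abs_of_nonneg (powerKernel_nonneg (hpos k) hs.1.le)]
  have key := hasSum_integral_of_summable_integral_norm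
    (μ := volume.restrict (Ioc 0 t))
    (F := fun (k : ℕ) s => (-1 : ℝ) ^ k * (powerKernel γ (t - s) * powerKernel (α * k + β) s))
    (fun k => (((intervalIntegrable_powerKernel_mul hγ (hpos k) ht).1).const_mul _))
    ((summable_powerKernel hα (add_pos hγ hβ) ht).congr fun k => (hnorm k).symm)
  rw [intervalIntegral.integral_of_le ht.le]
  have hleft : ∫ s in Ioc 0 t, powerKernel γ (t - s) * mittagLefflerKernel α β s
      = ∫ s in Ioc 0 t, ∑' k : ℕ,
        (-1 : ℝ) ^ k * (powerKernel γ (t - s) * powerKernel (α * k + β) s) := by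
    refine setIntegral_congr_fun measurableSet_Ioc fun s hs => ?_
    rw [← (hasSum_mittagLefflerKernel hα hβ hs.1).tsum_eq, ← tsum_mul_left]
    exact tsum_congr fun k => by ring
  rw [hleft, ← key.tsum_eq, ← (hasSum_mittagLefflerKernel hα (add_pos hγ hβ) ht).tsum_eq]
  refine tsum_congr fun k => ?_
  rw [integral_const_mul, ← intervalIntegral.integral_of_le ht.le, hterm k]
  congr 2
  ring

theorem intervalIntegral_nonneg_of_forall_mem_Ioo {f : ℝ → ℝ} {a b : ℝ} (hab : a ≤ b)
    (hf : ∀ x ∈ Ioo a b, 0 ≤ f x) : 0 ≤ ∫ x in a..b, f x := by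
  rw [intervalIntegral.integral_of_le hab, integral_Ioc_eq_integral_Ioo]
  exact setIntegral_nonneg measurableSet_Ioo hf

theorem mittagLeffler_zero (α β : ℝ) : mittagLeffler α β 0 = 1 / Real.Gamma β := by
  rw [mittagLeffler, tsum_eq_single 0 fun k hk => by simp [hk]]
  simp

/-- Positivity principle for solutions of the Volterra equation `f + k * f = h` with the
Riemann-Liouville kernel `k = powerKernel α`, `α < 1`, when `h / k` is nondecreasing. -/
theorem pos_of_add_integral_powerKernel_mul_eq {α : ℝ} (hα0 : 0 < α) (hα1 : α < 1) {f h : ℝ → ℝ}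
    (hf : ContinuousOn f (Ioi 0))
    (hint : ∀ t, 0 < t → IntervalIntegrable (fun s => powerKernel α (t - s) * f s) volume 0 t)
    (heq : ∀ t, 0 < t → f t + ∫ s in (0 : ℝ)..t, powerKernel α (t - s) * f s = h t)
    (hmono : MonotoneOn (fun t => t ^ (1 - α) * h t) (Ioi 0))
    (hnear : ∀ᶠ t in 𝓝[>] 0, 0 < f t) {t : ℝ} (ht : 0 < t) : 0 < f t := by
  by_contra! hneg
  obtain ⟨δ, hδ, hδf⟩ := mem_nhdsGT_iff_exists_Ioo_subset.1 hnear
  rw [mem_Ioi] at hδ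
  have hδt : δ ≤ t := by
    by_contra! hlt
    exact absurd (hδf ⟨ht, hlt⟩) (not_lt.2 hneg)
  obtain ⟨T, ⟨⟨hδT, hTt⟩, hfT⟩, hleast⟩ : ∃ T, IsLeast (Icc δ t ∩ f ⁻¹' Iic 0) T := by
    refine IsCompact.exists_isLeast ?_ ⟨t, ⟨hδt, le_rfl⟩, hneg⟩
    refine isCompact_Icc.of_isClosed_subset ?_ inter_subset_left
    exact (hf.mono fun x hx => hδ.trans_le hx.1).preimage_isClosed_of_isClosed
      isClosed_Icc isClosed_Iic
  have hT0 : 0 < T := hδ.trans_le hδT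
  have hpos (s : ℝ) (hs0 : 0 < s) (hsT : s < T) : 0 < f s := by
    by_contra! hs
    rcases lt_or_ge s δ with hlt | hge
    · exact absurd (hδf ⟨hs0, hlt⟩) (not_lt.2 hs)
    · exact absurd (hleast ⟨⟨hge, hsT.le.trans hTt⟩, hs⟩) (not_le.2 hsT)
  have hev : ∀ᶠ s in 𝓝 T, 0 < (s / T) ^ (1 - α) - powerKernel (1 + α) (T - s) := by
    have hcont : ContinuousAt
        (fun s : ℝ => (s / T) ^ (1 - α) - powerKernel (1 + α) (T - s)) T := by
      refine ContinuousAt.sub ?_ (ContinuousAt.div_const ?_ _)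
      · exact (continuousAt_id.div_const T).rpow_const (Or.inr (by linarith))
      · exact (continuousAt_const.sub continuousAt_id).rpow_const (Or.inr (by linarith))
    refine hcont.eventually (lt_mem_nhds ?_)
    simp [powerKernel, div_self hT0.ne', Real.zero_rpow hα0.ne']
  obtain ⟨ε, hε, hball⟩ := Metric.eventually_nhds_iff.1 hev
  obtain ⟨a, haT, ha0, haε⟩ : ∃ a, a < T ∧ 0 < a ∧ T - ε < a := by
    refine ⟨max (T / 2) (T - ε / 2), max_lt (by linarith) (by linarith),
      lt_max_of_lt_left (by linarith), lt_max_of_lt_right (by linarith)⟩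
  obtain ⟨m, ⟨ham, hmT'⟩, hmax⟩ := isCompact_Icc.exists_isMaxOn (nonempty_Icc.2 haT.le)
    (hf.mono fun x (hx : x ∈ Icc a T) => ha0.trans_le hx.1)
  have hfm : 0 < f m := (hpos a ha0 haT).trans_le (hmax ⟨le_rfl, haT.le⟩)
  have hmT : m < T := by
    refine lt_of_le_of_ne hmT' fun h => ?_
    rw [h] at hfm
    exact absurd hfm (not_lt.2 hfT)
  have hm0 : 0 < m := ha0.trans_le ham
  have hgap := hball (y := m) (by rw [Real.dist_eq, abs_lt]; constructor <;> linarith)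
  have hI1 : IntervalIntegrable (fun s => powerKernel α (T - s) * f s) volume 0 m :=
    (hint T hT0).mono_set (by
      rw [uIcc_of_le hm0.le, uIcc_of_le hT0.le]; exact Icc_subset_Icc_right hmT')
  have hI2 : IntervalIntegrable (fun s => powerKernel α (T - s) * f s) volume m T :=
    (hint T hT0).mono_set (by
      rw [uIcc_of_le hmT', uIcc_of_le hT0.le]; exact Icc_subset_Icc_left hm0.le)
  have hK : IntervalIntegrable (fun s => powerKernel α (T - s)) volume m T := by
    have h := intervalIntegrable_powerKernel_mul (β := 1) hα0 one_pos hT0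
    simp only [powerKernel_one, mul_one] at h
    exact h.mono_set (by
      rw [uIcc_of_le hmT', uIcc_of_le hT0.le]; exact Icc_subset_Icc_left hm0.le)
  have hratio (s : ℝ) (hs : s ∈ Ioo 0 m) :
      powerKernel α (T - s) ≤ (m / T) ^ (1 - α) * powerKernel α (m - s) := by
    have hms : 0 < m - s := by linarith [hs.2]
    have hTs : 0 < T - s := by linarith
    have h1 : (m - s) / (T - s) ≤ m / T := by
      rw [div_le_div_iff₀ hTs hT0]
      nlinarith [hs.1]
    have h2 := Real.rpow_le_rpow (by positivity) h1 (by linarith : (0 : ℝ) ≤ 1 - α)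
    rw [Real.div_rpow hms.le hTs.le, div_le_iff₀ (Real.rpow_pos_of_pos hTs _)] at h2
    have hinv (x : ℝ) (hx : 0 < x) : x ^ (α - 1) = (x ^ (1 - α))⁻¹ := by
      rw [← Real.rpow_neg hx.le, neg_sub]
    rw [powerKernel, powerKernel, ← mul_div_assoc, hinv _ hTs, hinv _ hms]
    refine div_le_div_of_nonneg_right ?_ (Real.Gamma_pos_of_pos hα0).le
    rw [← div_eq_mul_inv, le_div_iff₀ (by positivity), inv_mul_le_iff₀ (by positivity)]
    linarith
  have hleft : ∫ s in (0 : ℝ)..m, powerKernel α (T - s) * f s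
      ≤ (m / T) ^ (1 - α) * ∫ s in (0 : ℝ)..m, powerKernel α (m - s) * f s := by
    rw [← intervalIntegral.integral_const_mul]
    refine intervalIntegral.integral_mono_on_of_le_Ioo hm0.le hI1 ((hint m hm0).const_mul _) ?_
    intro s hs
    rw [← mul_assoc]
    exact mul_le_mul_of_nonneg_right (hratio s hs) (hpos s hs.1 (hs.2.trans hmT)).le
  have hright : ∫ s in m..T, powerKernel α (T - s) * f s
      ≤ powerKernel (1 + α) (T - m) * f m := by
    have hval : ∫ s in m..T, powerKernel α (T - s) = powerKernel (1 + α) (T - m) := by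
      rw [intervalIntegral.integral_comp_sub_left (fun s => powerKernel α s), sub_self,
        ← integral_powerKernel_mul one_pos hα0 (sub_pos.2 hmT)]
      simp only [powerKernel_one, one_mul]
    rw [← hval, ← intervalIntegral.integral_mul_const]
    refine intervalIntegral.integral_mono_on hmT' hI2 (hK.mul_const _) fun s hs => ?_
    exact mul_le_mul_of_nonneg_left (hmax ⟨ham.trans hs.1, hs.2⟩)
      (powerKernel_nonneg hα0 (sub_nonneg.2 hs.2))
  have heqT := heq T hT0
  have heqm := heq m hm0
  rw [← intervalIntegral.integral_add_adjacent_intervals hI1 hI2] at heqT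
  have hmono' : (m / T) ^ (1 - α) * h m ≤ h T := by
    have := hmono hm0 hT0 hmT'
    simp only at this
    rw [Real.div_rpow hm0.le hT0.le, div_mul_eq_mul_div,
      div_le_iff₀ (Real.rpow_pos_of_pos hT0 _)]
    linarith
  have hfT' : f T ≤ 0 := hfT
  rw [← heqm] at hmono'
  nlinarith [mul_pos hgap hfm]

section Resolvent

variable {α : ℝ}

theorem mittagLefflerKernel_self_pos (hα0 : 0 < α) (hα1 : α < 1) {t : ℝ} (ht : 0 < t) :
    0 < mittagLefflerKernel α α t := by
  refine pos_of_add_integral_powerKernel_mul_eq hα0 hα1 (h := powerKernel α)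
    (continuousOn_mittagLefflerKernel hα0 hα0)
    (fun s hs => intervalIntegrable_powerKernel_mul_mittagLefflerKernel hα0 hα0 hα0 hs)
    (fun s hs => ?_) ?_ ?_ ht
  · rw [integral_powerKernel_mul_mittagLefflerKernel hα0 hα0 hα0 hs,
      mittagLefflerKernel_eq_sub hα0 hα0 hs, sub_add_cancel]
  · have hconst (s : ℝ) (hs : 0 < s) : s ^ (1 - α) * powerKernel α s = 1 / Real.Gamma α := by
      rw [powerKernel, ← mul_div_assoc, ← Real.rpow_add hs]
      simp
    intro x hx y hy _
    exact ((hconst x hx).trans (hconst y hy).symm).le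
  · have hcont : ContinuousAt (fun t : ℝ => mittagLeffler α α (-t ^ α)) 0 :=
      ((continuous_mittagLeffler hα0 hα0).comp
        (Real.continuous_rpow_const hα0.le).neg).continuousAt
    have hev : ∀ᶠ t in 𝓝 (0 : ℝ), 0 < mittagLeffler α α (-t ^ α) := by
      refine hcont.eventually (lt_mem_nhds ?_)
      simp only [Real.zero_rpow hα0.ne', neg_zero, mittagLeffler_zero]
      exact one_div_pos.2 (Real.Gamma_pos_of_pos hα0)
    filter_upwards [hev.filter_mono nhdsWithin_le_nhds, self_mem_nhdsWithin] with s hs hs0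
    exact mul_pos (Real.rpow_pos_of_pos hs0 _) hs

theorem mittagLefflerKernel_one_nonneg (hα0 : 0 < α) (hα1 : α < 1) {t : ℝ} (ht : 0 < t) :
    0 ≤ mittagLefflerKernel α 1 t := by
  have h := integral_powerKernel_mul_mittagLefflerKernel hα0 hα0 (sub_pos.2 hα1) ht
  rw [sub_add_cancel] at h
  rw [← h]
  refine intervalIntegral_nonneg_of_forall_mem_Ioo ht.le fun s hs => ?_
  exact mul_nonneg (powerKernel_nonneg (sub_pos.2 hα1) (sub_nonneg.2 hs.2.le))
    (mittagLefflerKernel_self_pos hα0 hα1 hs.1).le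

theorem intervalIntegrable_mittagLefflerKernel_self (hα0 : 0 < α) {t : ℝ} (ht : 0 < t) :
    IntervalIntegrable (mittagLefflerKernel α α) volume 0 t := by
  simpa [powerKernel_one] using
    intervalIntegrable_powerKernel_mul_mittagLefflerKernel hα0 hα0 one_pos ht

theorem mittagLefflerKernel_one_eq_one_sub_integral (hα0 : 0 < α) {t : ℝ} (ht : 0 < t) :
    mittagLefflerKernel α 1 t = 1 - ∫ s in (0 : ℝ)..t, mittagLefflerKernel α α s := by
  have h := integral_powerKernel_mul_mittagLefflerKernel hα0 hα0 one_pos ht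
  simp only [powerKernel_one, one_mul] at h
  rw [h, mittagLefflerKernel_eq_sub hα0 one_pos ht, powerKernel_one, add_comm]

theorem mittagLefflerKernel_one_sub (hα0 : 0 < α) {a b : ℝ} (ha : 0 < a) (hb : 0 < b) :
    mittagLefflerKernel α 1 a - mittagLefflerKernel α 1 b
      = ∫ s in a..b, mittagLefflerKernel α α s := by
  rw [mittagLefflerKernel_one_eq_one_sub_integral hα0 ha,
    mittagLefflerKernel_one_eq_one_sub_integral hα0 hb,
    ← intervalIntegral.integral_interval_sub_left
      (intervalIntegrable_mittagLefflerKernel_self hα0 hb)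
      (intervalIntegrable_mittagLefflerKernel_self hα0 ha)]
  ring

theorem antitoneOn_mittagLefflerKernel_one (hα0 : 0 < α) (hα1 : α < 1) :
    AntitoneOn (mittagLefflerKernel α 1) (Ioi 0) := by
  intro a ha b hb hab
  rw [← sub_nonneg, mittagLefflerKernel_one_sub hα0 ha hb]
  exact intervalIntegral.integral_nonneg hab fun s hs =>
    (mittagLefflerKernel_self_pos hα0 hα1 (lt_of_lt_of_le ha hs.1)).le

theorem mittagLefflerKernel_one_le (hα0 : 0 < α) (hα1 : α < 1) {t : ℝ} (ht : 0 < t) :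
    mittagLefflerKernel α 1 t ≤ Real.Gamma (1 + α) * t ^ (-α) := by
  have hu := mittagLefflerKernel_one_nonneg hα0 hα1 ht
  have hle : powerKernel (1 + α) t * mittagLefflerKernel α 1 t ≤ 1 := by
    have hval := integral_powerKernel_mul hα0 one_pos ht
    have hconv := integral_powerKernel_mul_mittagLefflerKernel hα0 one_pos hα0 ht
    rw [add_comm 1 α, ← hval, ← intervalIntegral.integral_mul_const]
    calc _ ≤ ∫ s in (0 : ℝ)..t, powerKernel α (t - s) * mittagLefflerKernel α 1 s := by
          refine intervalIntegral.integral_mono_on_of_le_Ioo ht.le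
            ((intervalIntegrable_powerKernel_mul hα0 one_pos ht).mul_const _)
            (intervalIntegrable_powerKernel_mul_mittagLefflerKernel hα0 one_pos hα0 ht)
            fun s hs => ?_
          rw [powerKernel_one, mul_one]
          exact mul_le_mul_of_nonneg_left
            (antitoneOn_mittagLefflerKernel_one hα0 hα1 hs.1 ht hs.2.le)
            (powerKernel_nonneg hα0 (sub_nonneg.2 hs.2.le))
      _ ≤ 1 := by
          have := mittagLefflerKernel_eq_sub hα0 one_pos ht
          rw [powerKernel_one] at this
          rw [hconv]
          linarith
  have hΓ : 0 < Real.Gamma (1 + α) := Real.Gamma_pos_of_pos (by linarith)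
  have htα := Real.rpow_pos_of_pos ht α
  rw [powerKernel, add_sub_cancel_left, div_mul_eq_mul_div, div_le_one hΓ] at hle
  rw [Real.rpow_neg ht.le, ← div_eq_mul_inv, le_div_iff₀ htα]
  linarith

theorem powerKernel_mul_id_mul_mittagLefflerKernel_self (hα0 : 0 < α) {s t : ℝ} (hst : s ≤ t) :
    powerKernel α (t - s) * (s * mittagLefflerKernel α α s)
      = t * (powerKernel α (t - s) * mittagLefflerKernel α α s)
        - α * (powerKernel (α + 1) (t - s) * mittagLefflerKernel α α s) := by
  have := mul_powerKernel hα0 (sub_nonneg.2 hst)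
  linear_combination (-mittagLefflerKernel α α s) * this

theorem intervalIntegrable_powerKernel_mul_id_mul (hα0 : 0 < α) {t : ℝ} (ht : 0 < t) :
    IntervalIntegrable (fun s => powerKernel α (t - s) * (s * mittagLefflerKernel α α s))
      volume 0 t := by
  refine (((intervalIntegrable_powerKernel_mul_mittagLefflerKernel hα0 hα0 hα0 ht).const_mul
    t).sub ((intervalIntegrable_powerKernel_mul_mittagLefflerKernel hα0 hα0
      (by linarith : 0 < α + 1) ht).const_mul α)).congr fun s hs => ?_
  rw [uIoc_of_le ht.le] at hs
  exact (powerKernel_mul_id_mul_mittagLefflerKernel_self hα0 hs.2).symm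

theorem id_mul_mittagLefflerKernel_self_add_integral (hα0 : 0 < α) {t : ℝ} (ht : 0 < t) :
    t * mittagLefflerKernel α α t
      + ∫ s in (0 : ℝ)..t, powerKernel α (t - s) * (s * mittagLefflerKernel α α s)
      = α * (1 - mittagLefflerKernel α 1 t) := by
  have hα1 : 0 < α + 1 := by linarith
  have hI : ∫ s in (0 : ℝ)..t, powerKernel α (t - s) * (s * mittagLefflerKernel α α s)
      = t * mittagLefflerKernel α (α + α) t - α * mittagLefflerKernel α (α + 1 + α) t := by
    rw [← integral_powerKernel_mul_mittagLefflerKernel hα0 hα0 hα0 ht,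
      ← integral_powerKernel_mul_mittagLefflerKernel hα0 hα0 hα1 ht,
      ← intervalIntegral.integral_const_mul, ← intervalIntegral.integral_const_mul,
      ← intervalIntegral.integral_sub
        ((intervalIntegrable_powerKernel_mul_mittagLefflerKernel hα0 hα0 hα0 ht).const_mul t)
        ((intervalIntegrable_powerKernel_mul_mittagLefflerKernel hα0 hα0 hα1 ht).const_mul α)]
    refine intervalIntegral.integral_congr fun s hs => ?_
    rw [uIcc_of_le ht.le] at hs
    exact powerKernel_mul_id_mul_mittagLefflerKernel_self hα0 hs.2
  have h1 := mittagLefflerKernel_eq_sub hα0 hα0 ht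
  have h2 := mittagLefflerKernel_eq_sub hα0 hα1 ht
  have h3 := mittagLefflerKernel_eq_sub hα0 one_pos ht
  rw [powerKernel_one] at h3
  have h4 := mul_powerKernel hα0 ht.le
  rw [hI, add_comm (α + 1) α]
  linear_combination t * h1 + h4 - α * h2 + α * h3

theorem id_mul_mittagLefflerKernel_self_le (hα0 : 0 < α) (hα1 : α < 1) {t : ℝ} (ht : 0 < t) :
    t * mittagLefflerKernel α α t ≤ α := by
  have h := id_mul_mittagLefflerKernel_self_add_integral hα0 ht
  have hI : 0 ≤ ∫ s in (0 : ℝ)..t, powerKernel α (t - s) * (s * mittagLefflerKernel α α s) :=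
    intervalIntegral_nonneg_of_forall_mem_Ioo ht.le fun s hs =>
      mul_nonneg (powerKernel_nonneg hα0 (sub_nonneg.2 hs.2.le))
        (mul_nonneg hs.1.le (mittagLefflerKernel_self_pos hα0 hα1 hs.1).le)
  nlinarith [mul_nonneg hα0.le (mittagLefflerKernel_one_nonneg hα0 hα1 ht)]

theorem id_mul_mittagLefflerKernel_self_lt (hα0 : 0 < α) (hα1 : α < 1) {t : ℝ} (ht : 0 < t) :
    t * mittagLefflerKernel α α t < α / (1 - α) * mittagLefflerKernel α 1 t := by
  have hα1' : 0 < 1 - α := sub_pos.2 hα1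
  set C : ℝ := α / (1 - α) with hC
  have hC0 : 0 < C := by positivity
  have hCα : C - α = α * α / (1 - α) := by rw [hC]; field_simp; ring
  rw [← sub_pos]
  refine pos_of_add_integral_powerKernel_mul_eq hα0 hα1
    (f := fun s => C * mittagLefflerKernel α 1 s - s * mittagLefflerKernel α α s)
    (h := fun s => C - α + α * mittagLefflerKernel α 1 s) ?_ ?_ ?_ ?_ ?_ ht
  · exact (continuousOn_const.mul (continuousOn_mittagLefflerKernel hα0 one_pos)).sub
      (continuousOn_id.mul (continuousOn_mittagLefflerKernel hα0 hα0))
  · intro t ht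
    refine (((intervalIntegrable_powerKernel_mul_mittagLefflerKernel hα0 one_pos hα0 ht).const_mul
      C).sub (intervalIntegrable_powerKernel_mul_id_mul hα0 ht)).congr fun s _ => ?_
    ring
  · intro t ht
    have hI : ∫ s in (0 : ℝ)..t, powerKernel α (t - s)
          * (C * mittagLefflerKernel α 1 s - s * mittagLefflerKernel α α s)
        = C * mittagLefflerKernel α (α + 1) t
          - ∫ s in (0 : ℝ)..t, powerKernel α (t - s) * (s * mittagLefflerKernel α α s) := by
      rw [← integral_powerKernel_mul_mittagLefflerKernel hα0 one_pos hα0 ht,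
        ← intervalIntegral.integral_const_mul, ← intervalIntegral.integral_sub
        ((intervalIntegrable_powerKernel_mul_mittagLefflerKernel hα0 one_pos hα0 ht).const_mul C)
        (intervalIntegrable_powerKernel_mul_id_mul hα0 ht)]
      refine intervalIntegral.integral_congr fun s _ => ?_
      ring
    have h1 := id_mul_mittagLefflerKernel_self_add_integral hα0 ht
    have h2 := mittagLefflerKernel_eq_sub hα0 one_pos ht
    rw [powerKernel_one] at h2
    simp only [hI]
    linear_combination C * h2 - h1
  · intro a ha b hb hab
    have ha0 : 0 < a := ha
    have hb0 : 0 < b := hb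
    have hdiff : mittagLefflerKernel α 1 a - mittagLefflerKernel α 1 b
        ≤ α * Real.log (b / a) := by
      rw [mittagLefflerKernel_one_sub hα0 ha hb, ← integral_inv_of_pos ha hb,
        ← intervalIntegral.integral_const_mul]
      have hsub : uIcc a b ⊆ Ioi 0 := by
        rw [uIcc_of_le hab]; exact fun x hx => ha0.trans_le hx.1
      refine intervalIntegral.integral_mono_on hab
        ((continuousOn_mittagLefflerKernel hα0 hα0).mono hsub).intervalIntegrable
        (continuousOn_const.mul (continuousOn_id.inv₀ fun x hx =>
          (ne_of_gt (hsub hx)))).intervalIntegrable fun s hs => ?_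
      have hs0 : 0 < s := ha0.trans_le hs.1
      have := id_mul_mittagLefflerKernel_self_le hα0 hα1 hs0
      rw [← div_eq_mul_inv, le_div_iff₀ hs0]
      linarith
    have hexp : (1 - α) * Real.log (b / a) + 1 ≤ (b / a) ^ (1 - α) := by
      rw [Real.rpow_def_of_pos (by positivity), mul_comm]
      exact Real.add_one_le_exp _
    have hub := mittagLefflerKernel_one_nonneg hα0 hα1 hb0
    have hlog : 0 ≤ Real.log (b / a) := Real.log_nonneg ((one_le_div ha0).2 hab)
    set L := Real.log (b / a)
    set ua := mittagLefflerKernel α 1 a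
    set ub := mittagLefflerKernel α 1 b
    have hkey : C - α + α * ua ≤ (b / a) ^ (1 - α) * (C - α + α * ub) := by
      have hCα' : (1 - α) * (C - α) = α * α := by rw [hCα]; field_simp
      have hnn : 0 ≤ C - α + α * ub := by rw [hCα]; positivity
      calc C - α + α * ua ≤ C - α + α * (ub + α * L) := by gcongr; linarith
        _ = C - α + α * ub + (1 - α) * (C - α) * L := by rw [hCα']; ring
        _ ≤ ((1 - α) * L + 1) * (C - α + α * ub) := by
          nlinarith [mul_nonneg (mul_nonneg hα1'.le hlog) (mul_nonneg hα0.le hub)]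
        _ ≤ _ := by gcongr
    rw [Real.div_rpow hb0.le ha0.le, div_mul_eq_mul_div,
      le_div_iff₀ (Real.rpow_pos_of_pos ha0 _)] at hkey
    simp only
    linarith
  · have hcont : ContinuousAt
        (fun t : ℝ => C * mittagLeffler α 1 (-t ^ α) - t ^ α * mittagLeffler α α (-t ^ α)) 0 := by
      have hpow := Real.continuous_rpow_const (q := α) hα0.le
      exact ((continuous_const.mul ((continuous_mittagLeffler hα0 one_pos).comp hpow.neg)).sub
        (hpow.mul ((continuous_mittagLeffler hα0 hα0).comp hpow.neg))).continuousAt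
    have hev := hcont.eventually (lt_mem_nhds (a := 0) (by
      simp [Real.zero_rpow hα0.ne', mittagLeffler_zero, hC0]))
    filter_upwards [hev.filter_mono nhdsWithin_le_nhds, self_mem_nhdsWithin] with s hs hs0
    have hs0' : (0 : ℝ) < s := hs0
    have e : s * s ^ (α - 1) = s ^ α := by
      rw [Real.rpow_sub_one hs0'.ne']; field_simp
    simp only [mittagLefflerKernel, sub_self, Real.rpow_zero, one_mul]
    rwa [← mul_assoc, e]

theorem id_mul_mittagLefflerKernel_self_le_powerKernel (hα0 : 0 < α) (hα1 : α < 1) :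
    ∃ B, 0 < B ∧ ∀ s, 0 < s → s * mittagLefflerKernel α α s ≤ B * powerKernel (1 - α) s := by
  have hα1' : 0 < 1 - α := sub_pos.2 hα1
  have hΓ1 : 0 < Real.Gamma (1 - α) := Real.Gamma_pos_of_pos hα1'
  have hΓ2 : 0 < Real.Gamma (1 + α) := Real.Gamma_pos_of_pos (by linarith)
  refine ⟨α / (1 - α) * Real.Gamma (1 + α) * Real.Gamma (1 - α), by positivity, fun s hs => ?_⟩
  refine (id_mul_mittagLefflerKernel_self_lt hα0 hα1 hs).le.trans ?_
  calc α / (1 - α) * mittagLefflerKernel α 1 s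
      ≤ α / (1 - α) * (Real.Gamma (1 + α) * s ^ (-α)) := by
        gcongr
        exact mittagLefflerKernel_one_le hα0 hα1 hs
    _ = _ := by
        rw [powerKernel, show 1 - α - 1 = -α by ring]
        field_simp

theorem powerKernel_sub_sub_le (hα0 : 0 < α) (hα1 : α < 1) {s t : ℝ} (hs : 0 < s) (hst : s < t) :
    powerKernel (1 - α) (t - s) - powerKernel (1 - α) t ≤ s / t * powerKernel (1 - α) (t - s) := by
  have ht : 0 < t := hs.trans hst
  have hts : 0 < t - s := sub_pos.2 hst
  have hΓ : 0 < Real.Gamma (1 - α) := Real.Gamma_pos_of_pos (sub_pos.2 hα1)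
  have h : (t - s) * powerKernel (1 - α) (t - s) ≤ t * powerKernel (1 - α) t := by
    rw [mul_powerKernel (sub_pos.2 hα1) hts.le, mul_powerKernel (sub_pos.2 hα1) ht.le,
      powerKernel, powerKernel]
    have : 0 < Real.Gamma (1 - α + 1) := Real.Gamma_pos_of_pos (by linarith)
    have := Real.rpow_le_rpow hts.le (by linarith : t - s ≤ t) (by linarith : 0 ≤ 1 - α + 1 - 1)
    have : 0 < 1 - α := sub_pos.2 hα1
    gcongr
  rw [div_mul_eq_mul_div, le_div_iff₀ ht]
  linarith

theorem exists_abs_mittagLefflerKernel_one_sub_powerKernel_le (hα0 : 0 < α) (hα1 : α < 1) :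
    ∃ C, 0 < C ∧ ∀ t, 0 < t →
      |mittagLefflerKernel α 1 t - powerKernel (1 - α) t| ≤ C * t ^ (-(2 * α)) := by
  have hα1' : 0 < 1 - α := sub_pos.2 hα1
  have hΓ1 : 0 < Real.Gamma (1 - α) := Real.Gamma_pos_of_pos hα1'
  have hΓ2 : 0 < Real.Gamma (1 + α) := Real.Gamma_pos_of_pos (by linarith)
  have hΓ3 : 0 < Real.Gamma (1 - α + (1 - α)) := Real.Gamma_pos_of_pos (by linarith)
  obtain ⟨B, hB0, hB⟩ := id_mul_mittagLefflerKernel_self_le_powerKernel hα0 hα1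
  refine ⟨B / Real.Gamma (1 - α + (1 - α)) + Real.Gamma (1 + α) / Real.Gamma (1 - α),
    by positivity, fun t ht => ?_⟩
  set v : ℝ → ℝ := powerKernel (1 - α) with hv
  set u := mittagLefflerKernel α 1 t with hu
  set r := mittagLefflerKernel α α with hr
  have hvr := intervalIntegrable_powerKernel_mul_mittagLefflerKernel hα0 hα0 hα1' ht
  have hrint := intervalIntegrable_mittagLefflerKernel_self hα0 ht
  have hD : IntervalIntegrable (fun s => (v (t - s) - v t) * r s) volume 0 t :=
    (hvr.sub (hrint.const_mul (v t))).congr fun s _ => by simp only [hv, hr]; ring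
  have hid : u - v t + u * v t = ∫ s in (0 : ℝ)..t, (v (t - s) - v t) * r s := by
    have h1 := integral_powerKernel_mul_mittagLefflerKernel hα0 hα0 hα1' ht
    have h2 := mittagLefflerKernel_one_eq_one_sub_integral hα0 ht
    rw [sub_add_cancel] at h1
    simp only [sub_mul]
    rw [intervalIntegral.integral_sub hvr (hrint.const_mul _),
      intervalIntegral.integral_const_mul, h1]
    linear_combination v t * h2
  have hlow : 0 ≤ ∫ s in (0 : ℝ)..t, (v (t - s) - v t) * r s := by
    refine intervalIntegral_nonneg_of_forall_mem_Ioo ht.le fun s hs => ?_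
    refine mul_nonneg (sub_nonneg.2 ?_) (mittagLefflerKernel_self_pos hα0 hα1 hs.1).le
    exact div_le_div_of_nonneg_right (Real.rpow_le_rpow_of_nonpos (sub_pos.2 hs.2)
      (by linarith [hs.1]) (by linarith)) hΓ1.le
  have hup : ∫ s in (0 : ℝ)..t, (v (t - s) - v t) * r s
      ≤ B / Real.Gamma (1 - α + (1 - α)) * t ^ (-(2 * α)) := by
    have hvv := intervalIntegrable_powerKernel_mul hα1' hα1' ht
    calc _ ≤ ∫ s in (0 : ℝ)..t, B / t * (v (t - s) * v s) := by
          refine intervalIntegral.integral_mono_on_of_le_Ioo ht.le hD (hvv.const_mul _)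
            fun s hs => ?_
          have hvpos := powerKernel_nonneg hα1' (sub_nonneg.2 hs.2.le)
          calc _ ≤ s / t * v (t - s) * r s :=
                mul_le_mul_of_nonneg_right (powerKernel_sub_sub_le hα0 hα1 hs.1 hs.2)
                  (mittagLefflerKernel_self_pos hα0 hα1 hs.1).le
            _ = v (t - s) / t * (s * r s) := by ring
            _ ≤ v (t - s) / t * (B * v s) :=
                mul_le_mul_of_nonneg_left (hB s hs.1) (by positivity)
            _ = _ := by ring
      _ = _ := by
          rw [intervalIntegral.integral_const_mul, hv, integral_powerKernel_mul hα1' hα1' ht,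
            powerKernel, show 1 - α + (1 - α) - 1 = -(2 * α) + 1 by ring,
            Real.rpow_add_one ht.ne']
          field_simp
  have huv : u * v t ≤ Real.Gamma (1 + α) / Real.Gamma (1 - α) * t ^ (-(2 * α)) := by
    calc u * v t ≤ Real.Gamma (1 + α) * t ^ (-α) * v t :=
          mul_le_mul_of_nonneg_right (mittagLefflerKernel_one_le hα0 hα1 ht)
            (powerKernel_nonneg hα1' ht.le)
      _ = _ := by
          rw [hv, powerKernel, show 1 - α - 1 = -α by ring,
            show -(2 * α) = -α + -α by ring, Real.rpow_add ht]
          ring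
  have huv0 : 0 ≤ u * v t :=
    mul_nonneg (mittagLefflerKernel_one_nonneg hα0 hα1 ht) (powerKernel_nonneg hα1' ht.le)
  have hp1 : 0 ≤ B / Real.Gamma (1 - α + (1 - α)) * t ^ (-(2 * α)) := by positivity
  have hp2 : 0 ≤ Real.Gamma (1 + α) / Real.Gamma (1 - α) * t ^ (-(2 * α)) := by positivity
  rw [add_mul, abs_le]
  constructor <;> linarith

theorem mittagLeffler_neg_eq (hα0 : 0 < α) {x : ℝ} (hx : 0 < x) :
    mittagLeffler α 1 (-x) = mittagLefflerKernel α 1 (x ^ α⁻¹) := by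
  rw [mittagLefflerKernel, Real.rpow_inv_rpow hx.le hα0.ne', sub_self, Real.rpow_zero, one_mul]

theorem abs_mittagLeffler_neg_le (hα0 : 0 < α) (hα1 : α < 1) {x : ℝ} (hx : 0 < x) :
    |mittagLeffler α 1 (-x)| ≤ Real.Gamma (1 + α) / x := by
  have ht : 0 < x ^ α⁻¹ := Real.rpow_pos_of_pos hx _
  rw [mittagLeffler_neg_eq hα0 hx, abs_of_nonneg (mittagLefflerKernel_one_nonneg hα0 hα1 ht)]
  refine (mittagLefflerKernel_one_le hα0 hα1 ht).trans_eq ?_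
  rw [Real.rpow_neg ht.le, Real.rpow_inv_rpow hx.le hα0.ne', div_eq_mul_inv]

theorem exists_abs_mittagLeffler_neg_sub_le (hα0 : 0 < α) (hα1 : α < 1) :
    ∃ C, 0 < C ∧ ∀ x, 0 < x →
      |mittagLeffler α 1 (-x) - 1 / (Real.Gamma (1 - α) * x)| ≤ C / x ^ 2 := by
  obtain ⟨C, hC0, hC⟩ := exists_abs_mittagLefflerKernel_one_sub_powerKernel_le hα0 hα1
  refine ⟨C, hC0, fun x hx => ?_⟩
  have ht : 0 < x ^ α⁻¹ := Real.rpow_pos_of_pos hx _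
  have hxα : (x ^ α⁻¹) ^ α = x := Real.rpow_inv_rpow hx.le hα0.ne'
  have h := hC _ ht
  rw [powerKernel, show 1 - α - 1 = -α by ring, show -(2 * α) = -α + -α by ring,
    Real.rpow_add ht, Real.rpow_neg ht.le, hxα, ← mittagLeffler_neg_eq hα0 hx] at h
  convert h using 1
  · congr 2
    field_simp
  · field_simp

end Resolvent


/-- Let `0 < α < 1`, `(λ_n)` positive with `λ_n ≥ λ_0 > 0` for all `n` (the sequences are
indexed by `ℕ`, so the first entry has index `0`), and `(ψ_n)` real with
`∑ |ψ_n|/λ_n < ∞` and `∑ |ψ_n|/λ_n² < ∞`. Then there are `C > 0` and `t₀ > 0` such that for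
all `t ≥ t₀`,
`|∑_n E_{α,1}(-λ_n t^α) ψ_n - (1/(Γ(1-α) t^α)) ∑_n ψ_n/λ_n| ≤ C t^{-2α}`. -/
theorem mittagLeffler_sum_asymptotic
    (α : ℝ) (hα0 : 0 < α) (hα1 : α < 1)
    (lam ψ : ℕ → ℝ) (hlam0 : 0 < lam 0) (hlam : ∀ n, lam 0 ≤ lam n)
    (hsum1 : Summable (fun n => |ψ n| / lam n))
    (hsum2 : Summable (fun n => |ψ n| / lam n ^ 2)) :
    ∃ C > (0 : ℝ), ∃ t₀ > (0 : ℝ), ∀ t ≥ t₀,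
      |(∑' n, mittagLeffler α 1 (-lam n * t ^ α) * ψ n)
          - (1 / (Real.Gamma (1 - α) * t ^ α)) * ∑' n, ψ n / lam n|
        ≤ C * t ^ (-(2 * α)) := by
  have hlam_pos (n : ℕ) : 0 < lam n := hlam0.trans_le (hlam n)
  obtain ⟨C, hC0, hC⟩ := exists_abs_mittagLeffler_neg_sub_le hα0 hα1
  set S := ∑' n, |ψ n| / lam n ^ 2 with hS
  have hS0 : 0 ≤ S := tsum_nonneg fun n => by positivity
  refine ⟨C * S + 1, by positivity, 1, one_pos, fun t ht => ?_⟩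
  have ht0 : 0 < t := by linarith
  have hX : 0 < t ^ α := Real.rpow_pos_of_pos ht0 α
  have hpow : t ^ (-(2 * α)) = 1 / (t ^ α) ^ 2 := by
    rw [show -(2 * α) = -α + -α by ring, Real.rpow_add ht0, Real.rpow_neg ht0.le]
    field_simp
  set X := t ^ α
  have hx (n : ℕ) : 0 < lam n * X := mul_pos (hlam_pos n) hX
  have hsummable_ml : Summable (fun n => mittagLeffler α 1 (-lam n * X) * ψ n) := by
    refine Summable.of_norm_bounded (hsum1.mul_left (Real.Gamma (1 + α) / X)) fun n => ?_
    rw [norm_mul, Real.norm_eq_abs, Real.norm_eq_abs, neg_mul]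
    calc _ ≤ Real.Gamma (1 + α) / (lam n * X) * |ψ n| :=
          mul_le_mul_of_nonneg_right (abs_mittagLeffler_neg_le hα0 hα1 (hx n)) (abs_nonneg _)
      _ = _ := by field_simp
  have hsummable_ratio : Summable (fun n => ψ n / lam n) := by
    refine Summable.of_norm_bounded hsum1 fun n => ?_
    rw [norm_div, Real.norm_eq_abs, Real.norm_eq_abs, abs_of_pos (hlam_pos n)]
  rw [← tsum_mul_left, ← hsummable_ml.tsum_sub (hsummable_ratio.mul_left _), hpow]
  have hterm (n : ℕ) : ‖mittagLeffler α 1 (-lam n * X) * ψ n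
      - 1 / (Real.Gamma (1 - α) * X) * (ψ n / lam n)‖ ≤ C / X ^ 2 * (|ψ n| / lam n ^ 2) := by
    have hfac : mittagLeffler α 1 (-lam n * X) * ψ n
        - 1 / (Real.Gamma (1 - α) * X) * (ψ n / lam n)
        = (mittagLeffler α 1 (-(lam n * X)) - 1 / (Real.Gamma (1 - α) * (lam n * X))) * ψ n := by
      rw [neg_mul, sub_mul]
      congr 1
      have := (Real.Gamma_pos_of_pos (sub_pos.2 hα1)).ne'
      have := (hlam_pos n).ne'
      field_simp
    rw [hfac, norm_mul, Real.norm_eq_abs, Real.norm_eq_abs]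
    calc _ ≤ C / (lam n * X) ^ 2 * |ψ n| :=
          mul_le_mul_of_nonneg_right (hC _ (hx n)) (abs_nonneg _)
      _ = _ := by field_simp
  have hbound := tsum_of_norm_bounded (hsum2.hasSum.mul_left (C / X ^ 2)) hterm
  rw [Real.norm_eq_abs] at hbound
  refine hbound.trans ?_
  rw [← hS, div_mul_eq_mul_div, mul_one_div]
  gcongr
  linarith
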